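/- The paths P_σ(x) for x ∈ D_n are pairwise vertex-disjoint and together visit every bitstring of length 2n with weight n or n+1 exactly once. -/

import Mathlib

/-- A bitstring is a Dyck word if it has as many 1s (`true`) as 0s (`false`) and
every prefix has at least as many 1s as 0s. -/
def isDyck (x : List Bool) : Prop :=
  x.count true = x.count false ∧
  ∀ k : ℕ, (x.take k).count false ≤ (x.take k).count true

/-- The set `D_n` of Dyck words of length `2n`. -/
def dyckWords (n : ℕ) : Set (List Bool) := {x | x.length = 2 * n ∧ isDyck x}

/-- Flip the bit at (1-indexed) position `p` of the bitstring `y`. -/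
def flipAt (y : List Bool) (p : ℕ) : List Bool :=
  y.set (p - 1) (!(y.getD (p - 1) false))

/-- The set of vertices of the path obtained from `x` by successively flipping the
positions in the flip sequence `σx`. -/
def pathVerts (σx : List ℕ) (x : List Bool) : Set (List Bool) :=
  {y | ∃ k : ℕ, k ≤ σx.length ∧ y = (σx.take k).foldl flipAt x}

/-- Height change of a bitstring. -/
def tot : List Bool → ℤ
  | [] => 0
  | b :: l => (if b then 1 else -1) + tot l

/-- All prefixes, started from height `h`, stay nonnegative. -/
def good : ℤ → List Bool → Prop
  | h, [] => 0 ≤ h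
  | h, b :: l => 0 ≤ h ∧ good (h + if b then 1 else -1) l

theorem tot_append (a b : List Bool) : tot (a ++ b) = tot a + tot b := by
  induction a with
  | nil => simp [tot]
  | cons x a ih => simp [tot, ih]; ring

theorem good_nonneg {h : ℤ} {a : List Bool} (H : good h a) : 0 ≤ h := by
  cases a with
  | nil => exact H
  | cons x a => exact H.1

theorem good_append (h : ℤ) (a b : List Bool) :
    good h (a ++ b) ↔ good h a ∧ good (h + tot a) b := by
  induction a generalizing h with
  | nil => simp only [List.nil_append, good, tot, add_zero]
           exact ⟨fun H => ⟨good_nonneg H, H⟩, fun H => H.2⟩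
  | cons x a ih => simp only [List.cons_append, good, tot, ih, and_assoc, add_assoc]

theorem good_mono {h h' : ℤ} {a : List Bool} (hh : h ≤ h') (H : good h a) : good h' a := by
  induction a generalizing h h' with
  | nil => exact le_trans H hh
  | cons x a ih => exact ⟨le_trans H.1 hh, ih (by linarith) H.2⟩

theorem tot_eq_count (x : List Bool) : tot x = (x.count true : ℤ) - x.count false := by
  induction x with
  | nil => simp [tot]
  | cons b x ih => cases b <;> simp [tot, ih] <;> ring

theorem good_iff_take (h : ℤ) (x : List Bool) : good h x ↔ ∀ k : ℕ, 0 ≤ h + tot (x.take k) := by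
  induction x generalizing h with
  | nil => simp [good, tot]
  | cons b x ih =>
    simp only [good, ih]
    constructor
    · rintro ⟨h1, h2⟩ k
      cases k with
      | zero => simpa [tot] using h1
      | succ k => have := h2 k; simp only [List.take_succ_cons, tot]; linarith
    · intro H
      refine ⟨by simpa [tot] using H 0, fun k => ?_⟩
      have := H (k + 1)
      simp only [List.take_succ_cons, tot] at this
      linarith

theorem isDyck_iff (x : List Bool) : isDyck x ↔ tot x = 0 ∧ good 0 x := by
  rw [isDyck, good_iff_take, tot_eq_count]
  refine and_congr (by omega) (forall_congr' fun k => ?_)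
  rw [tot_eq_count]; omega

/-- First descent below zero. -/
theorem decomp_first (r : List Bool) (h : ¬ good 0 r) :
    ∃ u z, isDyck u ∧ r = u ++ false :: z := by
  induction r using List.reverseRecOn with
  | nil => simp [good] at h
  | append_singleton r c ih =>
    by_cases hr : good 0 r
    · have h1 := good_iff_take 0 r |>.1 hr r.length
      rw [good_append] at h
      simp only [List.take_length, zero_add] at h1
      cases c with
      | true => exact absurd ⟨hr, by simp only [good]; refine ⟨by linarith, ?_⟩; simp; linarith⟩ h
      | false =>
        refine ⟨r, [], ?_, rfl⟩
        rw [isDyck_iff]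
        refine ⟨?_, hr⟩
        by_contra hne
        apply h
        refine ⟨hr, ?_⟩
        simp only [good]
        refine ⟨by linarith, ?_⟩
        simp
        omega
    · obtain ⟨u, z, hu, rfl⟩ := ih hr
      exact ⟨u, z ++ [c], hu, by simp⟩

/-- Last ascent. -/
theorem decomp_last (r : List Bool) (h : ∃ p q, r = p ++ q ∧ 0 < tot q) :
    ∃ z v, isDyck v ∧ r = z ++ true :: v := by
  induction r with
  | nil =>
    obtain ⟨p, q, h1, h2⟩ := h
    simp at h1
    simp [h1, tot] at h2
  | cons c r ih =>
    by_cases hr : ∃ p q, r = p ++ q ∧ 0 < tot q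
    · obtain ⟨z, v, hv, rfl⟩ := ih hr
      exact ⟨c :: z, v, hv, rfl⟩
    · push Not at hr
      obtain ⟨p, q, h1, h2⟩ := h
      cases p with
      | cons d p =>
        simp only [List.cons_append, List.cons.injEq] at h1
        exact absurd h2 (not_lt.2 (hr p q h1.2))
      | nil =>
        simp only [List.nil_append] at h1
        subst h1
        have h3 := hr [] r rfl
        cases c with
        | false => simp [tot] at h2; omega
        | true =>
          simp [tot] at h2
          refine ⟨[], r, ?_, rfl⟩
          rw [isDyck_iff]
          refine ⟨by omega, ?_⟩
          rw [good_iff_take]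
          intro k
          have h4 := hr (r.take k) (r.drop k) (by simp)
          have h5 : tot r = tot (r.take k) + tot (r.drop k) := by
            rw [← tot_append]; simp
          omega

theorem dyck_prefix {p q : List Bool} (h : isDyck (p ++ q)) : 0 ≤ tot p := by
  rw [isDyck_iff, good_append] at h
  simpa using good_nonneg h.2.2

theorem split_first {u u' z z' : List Bool} (hu : isDyck u) (hu' : isDyck u')
    (h : u ++ false :: z = u' ++ false :: z') : u = u' ∧ z = z' := by
  have t1 := ((isDyck_iff _).1 hu).1
  have t2 := ((isDyck_iff _).1 hu').1
  rcases List.append_eq_append_iff.1 h with ⟨a, h1, h2⟩ | ⟨a, h1, h2⟩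
  · cases a with
    | nil => simp at h1 h2; exact ⟨h1.symm, h2⟩
    | cons c a =>
      simp at h2
      rw [h1, h2.1, ← List.singleton_append, ← List.append_assoc] at hu'
      have := dyck_prefix hu'
      simp [tot_append, tot, t1] at this
  · cases a with
    | nil => simp at h1 h2; exact ⟨h1, h2.symm⟩
    | cons c a =>
      simp at h2
      rw [h1, h2.1, ← List.singleton_append, ← List.append_assoc] at hu
      have := dyck_prefix hu
      simp [tot_append, tot, t2] at this

theorem split_last {v v' z z' : List Bool} (hv : isDyck v) (hv' : isDyck v')
    (h : z ++ true :: v = z' ++ true :: v') : z = z' ∧ v = v' := by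
  have t1 := ((isDyck_iff _).1 hv).1
  have t2 := ((isDyck_iff _).1 hv').1
  have t3 : tot z = tot z' := by
    have := congrArg tot h
    simpa [tot_append, tot, t1, t2] using this
  rcases List.append_eq_append_iff.1 h with ⟨a, h1, h2⟩ | ⟨a, h1, h2⟩
  · cases a with
    | nil => simp at h1 h2; exact ⟨h1.symm, h2⟩
    | cons c a =>
      simp at h2
      obtain ⟨rfl, rfl⟩ := h2
      have := dyck_prefix hv
      rw [h1] at t3
      simp [tot_append, tot] at t3
      omega
  · cases a with
    | nil => simp at h1 h2; exact ⟨h1, h2.symm⟩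
    | cons c a =>
      simp at h2
      obtain ⟨rfl, rfl⟩ := h2
      have := dyck_prefix hv'
      rw [h1] at t3
      simp [tot_append, tot] at t3
      omega

theorem dyck_ne_split {v z : List Bool} (hv : isDyck v) (h : isDyck (z ++ true :: v)) : False := by
  have t1 := ((isDyck_iff _).1 hv).1
  have t2 := ((isDyck_iff _).1 h).1
  have := dyck_prefix h
  simp [tot_append, tot, t1] at t2
  omega

/-- Binary trees, encoding Dyck words. -/
inductive DT where
  | leaf : DT
  | node : DT → DT → DT

/-- The Dyck word of a tree. -/
def word : DT → List Bool
  | .leaf => []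
  | .node u v => true :: (word u ++ false :: word v)

theorem word_dyck (t : DT) : isDyck (word t) := by
  rw [isDyck_iff]
  induction t with
  | leaf => simp [word, tot, good]
  | node u v hu hv =>
    simp only [word, tot, good, tot_append, good_append, hu.1, hv.1]
    simp only [if_true, Bool.false_eq_true, if_false]
    refine ⟨by norm_num, le_refl _, good_mono (by norm_num) hu.2, by norm_num, ?_⟩
    simpa using hv.2

theorem tot_word (t : DT) : tot (word t) = 0 := ((isDyck_iff _).1 (word_dyck t)).1

theorem exists_word (x : List Bool) (h : isDyck x) : ∃ t, word t = x := by
  induction hk : x.length using Nat.strong_induction_on generalizing x with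
  | _ k ih =>
  subst hk
  cases x with
  | nil => exact ⟨.leaf, rfl⟩
  | cons b r =>
    rw [isDyck_iff] at h
    cases b with
    | false =>
      have := good_nonneg h.2.2
      simp at this
    | true =>
      simp [tot] at h
      have hb : ¬ good 0 r := by
        intro hg
        have := (good_iff_take 0 r).1 hg r.length
        simp at this
        omega
      obtain ⟨u, v, hu, rfl⟩ := decomp_first r hb
      have t1 := ((isDyck_iff _).1 hu).1
      have hv : isDyck v := by
        rw [isDyck_iff]
        have h2 := h.2.2
        have h1 := h.1
        simp [tot_append, tot, t1, good, good_append] at h1 h2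
        exact ⟨by omega, h2.2⟩
      obtain ⟨tu, rfl⟩ := ih u.length (by simp <;> omega) u hu rfl
      obtain ⟨tv, rfl⟩ := ih v.length (by simp <;> omega) v hv rfl
      exact ⟨.node tu tv, rfl⟩

theorem word_inj {t t' : DT} (h : word t = word t') : t = t' := by
  induction t generalizing t' with
  | leaf => cases t' with
    | leaf => rfl
    | node u v => simp [word] at h
  | node u v hu hv => cases t' with
    | leaf => simp [word] at h
    | node u' v' =>
      simp only [word, List.cons.injEq, true_and] at h
      obtain ⟨h1, h2⟩ := split_first (word_dyck _) (word_dyck _) h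
      rw [hu h1, hv h2]

/-- Vertices of the paths from `0w` to `w0`. -/
inductive VT where
  | a : DT → VT
  | b : DT → DT → VT
  | c : VT → DT → VT
  | d : DT → DT → VT
  | e : DT → VT → VT

def vstr : VT → List Bool
  | .a t => false :: word t
  | .b u v => false :: (true :: word u ++ true :: word v)
  | .c z v => false :: (vstr z ++ true :: word v)
  | .d u v => true :: (word u ++ false :: (true :: word v))
  | .e u z => true :: (word u ++ false :: vstr z)

def vtree : VT → DT
  | .a t => t
  | .b u v => .node u v
  | .c z v => .node (vtree z) v
  | .d u v => .node u v
  | .e u z => .node u (vtree z)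

/-- Path vertices, first part. -/
def Pfst (q : List VT) (u v : DT) : List VT :=
  [VT.a (.node u v), VT.b u v] ++ q.map (fun z => VT.c z v)

def Qs : DT → List VT
  | .leaf => [VT.a .leaf]
  | .node u v => Pfst (Qs u) u v ++ VT.d u v :: (Qs v).map (fun z => VT.e u z)

theorem vtree_of_mem {t : DT} {z : VT} (h : z ∈ Qs t) : vtree z = t := by
  induction t generalizing z with
  | leaf => simp [Qs] at h; subst h; rfl
  | node u v hu hv =>
    simp [Qs, Pfst] at h
    rcases h with rfl | rfl | ⟨y, hy, rfl⟩ | rfl | ⟨y, hy, rfl⟩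
    · rfl
    · rfl
    · simp [vtree, hu hy]
    · rfl
    · simp [vtree, hv hy]

theorem a_mem (t : DT) : VT.a t ∈ Qs t := by
  cases t <;> simp [Qs, Pfst]

theorem mem_Qs (z : VT) : z ∈ Qs (vtree z) := by
  induction z with
  | a t => exact a_mem t
  | b u v => simp [vtree, Qs, Pfst]
  | c z v ih => simp [vtree, Qs, Pfst, ih]
  | d u v => simp [vtree, Qs, Pfst]
  | e u z ih => simp [vtree, Qs, Pfst, ih]

theorem Qs_nodup (t : DT) : (Qs t).Nodup := by
  induction t with
  | leaf => simp [Qs]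
  | node u v hu hv =>
    have h1 : ((Qs u).map (fun z => VT.c z v)).Nodup :=
      hu.map (fun x y h => by simpa using h)
    have h2 : ((Qs v).map (fun z => VT.e u z)).Nodup :=
      hv.map (fun x y h => by simpa using h)
    simp [Qs, Pfst, List.nodup_append, h1, h2]

theorem Pfst_nodup (u v : DT) : (Pfst (Qs u) u v).Nodup := by
  have := Qs_nodup (.node u v)
  rw [Qs, List.nodup_append] at this
  exact this.1

theorem vstr_length (z : VT) : (vstr z).length = (word (vtree z)).length + 1 := by
  induction z <;> simp_all [vstr, vtree, word] <;> omega

theorem vstr_ne (z : VT) {w : List Bool} (hw : isDyck w) : vstr z ≠ true :: w := by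
  intro h
  cases z <;> simp [vstr] at h
  all_goals
    subst h
    rw [← List.singleton_append, ← List.append_assoc] at hw
    have := dyck_prefix hw
    simp [tot_append, tot, tot_word] at this

theorem vstr_inj {z z' : VT} (h : vstr z = vstr z') : z = z' := by
  induction z generalizing z' with
  | a t =>
    cases z' with
    | a t' => simp [vstr] at h; rw [word_inj h]
    | b u v =>
      simp only [vstr, List.cons.injEq, true_and] at h
      exact (dyck_ne_split (word_dyck v) (h ▸ word_dyck t)).elim
    | c z v =>
      simp only [vstr, List.cons.injEq, true_and] at h
      exact (dyck_ne_split (word_dyck v) (h ▸ word_dyck t)).elim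
    | d u v => simp [vstr] at h
    | e u z => simp [vstr] at h
  | b u v =>
    cases z' with
    | a t =>
      simp only [vstr, List.cons.injEq, true_and] at h
      exact (dyck_ne_split (word_dyck v) (h ▸ word_dyck t)).elim
    | b u' v' =>
      simp only [vstr, List.cons.injEq, true_and] at h
      obtain ⟨h1, h2⟩ := split_last (word_dyck _) (word_dyck _) h
      simp only [List.cons.injEq, true_and] at h1
      rw [word_inj h1, word_inj h2]
    | c z v' =>
      simp only [vstr, List.cons.injEq, true_and] at h
      obtain ⟨h1, h2⟩ := split_last (word_dyck _) (word_dyck _) h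
      exact (vstr_ne z (word_dyck u) h1.symm).elim
    | d u v => simp [vstr] at h
    | e u z => simp [vstr] at h
  | c z v ih =>
    cases z' with
    | a t =>
      simp only [vstr, List.cons.injEq, true_and] at h
      exact (dyck_ne_split (word_dyck v) (h ▸ word_dyck t)).elim
    | b u' v' =>
      simp only [vstr, List.cons.injEq, true_and] at h
      obtain ⟨h1, h2⟩ := split_last (word_dyck _) (word_dyck _) h
      exact (vstr_ne z (word_dyck _) h1).elim
    | c z' v' =>
      simp only [vstr, List.cons.injEq, true_and] at h
      obtain ⟨h1, h2⟩ := split_last (word_dyck _) (word_dyck _) h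
      rw [ih h1, word_inj h2]
    | d u v => simp [vstr] at h
    | e u z => simp [vstr] at h
  | d u v =>
    cases z' with
    | a t => simp [vstr] at h
    | b u' v' => simp [vstr] at h
    | c z' v' => simp [vstr] at h
    | d u' v' =>
      simp only [vstr, List.cons.injEq, true_and] at h
      obtain ⟨h1, h2⟩ := split_first (word_dyck _) (word_dyck _) h
      simp only [List.cons.injEq, true_and] at h2
      rw [word_inj h1, word_inj h2]
    | e u' z =>
      simp only [vstr, List.cons.injEq, true_and] at h
      obtain ⟨h1, h2⟩ := split_first (word_dyck _) (word_dyck _) h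
      exact (vstr_ne z (word_dyck _) h2.symm).elim
  | e u z ih =>
    cases z' with
    | a t => simp [vstr] at h
    | b u' v' => simp [vstr] at h
    | c z' v' => simp [vstr] at h
    | d u' v' =>
      simp only [vstr, List.cons.injEq, true_and] at h
      obtain ⟨h1, h2⟩ := split_first (word_dyck _) (word_dyck _) h
      exact (vstr_ne z (word_dyck _) h2).elim
    | e u' z' =>
      simp only [vstr, List.cons.injEq, true_and] at h
      obtain ⟨h1, h2⟩ := split_first (word_dyck _) (word_dyck _) h
      rw [word_inj h1, ih h2]

theorem tot_vstr (z : VT) : tot (vstr z) = -1 ∨ tot (vstr z) = 1 := by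
  induction z with
  | a t => simp [vstr, tot, tot_word]
  | b u v => simp [vstr, tot, tot_append, tot_word]
  | c z v ih => simp [vstr, tot, tot_append, tot_word]; omega
  | d u v => simp [vstr, tot, tot_append, tot_word]
  | e u z ih => simp [vstr, tot, tot_append, tot_word]; omega

theorem vstr_surj (y : List Bool)
    (h : tot y = -1 ∨ (tot y = 1 ∧ ∀ w, isDyck w → y ≠ true :: w)) : ∃ z, vstr z = y := by
  induction hk : y.length using Nat.strong_induction_on generalizing y with
  | _ k ih =>
  subst hk
  cases y with
  | nil => simp [tot] at h
  | cons c r =>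
    cases c with
    | false =>
      by_cases hd : isDyck r
      · obtain ⟨t, rfl⟩ := exists_word r hd
        exact ⟨.a t, rfl⟩
      · have hs : ∃ p q, r = p ++ q ∧ 0 < tot q := by
          rcases h with h | h
          · simp [tot] at h
            rw [isDyck_iff, good_iff_take] at hd
            push Not at hd
            obtain ⟨k, hk⟩ := hd (by omega)
            refine ⟨r.take k, r.drop k, by simp, ?_⟩
            have h5 : tot r = tot (r.take k) + tot (r.drop k) := by
              rw [← tot_append]; simp
            omega
          · have := h.1
            simp [tot] at this
            exact ⟨[], r, rfl, by omega⟩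
        obtain ⟨z, v, hv, rfl⟩ := decomp_last r hs
        obtain ⟨tv, rfl⟩ := exists_word v hv
        by_cases hz : ∃ w, isDyck w ∧ z = true :: w
        · obtain ⟨w, hw, rfl⟩ := hz
          obtain ⟨tw, rfl⟩ := exists_word w hw
          exact ⟨.b tw tv, rfl⟩
        · push Not at hz
          have h1 : tot z = -1 ∨ tot z = 1 := by
            simp [tot, tot_append, tot_word] at h
            omega
          obtain ⟨t, rfl⟩ := ih z.length (by simp <;> omega) z (h1.imp id fun h => ⟨h, hz⟩) rfl
          exact ⟨.c t tv, rfl⟩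
    | true =>
      have hb : ¬ good 0 r := by
        intro hg
        have h0 := (good_iff_take 0 r).1 hg r.length
        simp at h0
        rcases h with h | ⟨h, h'⟩
        · simp [tot] at h
          omega
        · simp [tot] at h
          exact h' r ((isDyck_iff _).2 ⟨h, hg⟩) rfl
      obtain ⟨u, z, hu, rfl⟩ := decomp_first r hb
      obtain ⟨tu, rfl⟩ := exists_word u hu
      by_cases hz : ∃ w, isDyck w ∧ z = true :: w
      · obtain ⟨w, hw, rfl⟩ := hz
        obtain ⟨tw, rfl⟩ := exists_word w hw
        exact ⟨.d tu tw, rfl⟩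
      · push Not at hz
        have h1 : tot z = -1 ∨ tot z = 1 := by
          simp [tot, tot_append, tot_word] at h
          omega
        obtain ⟨t, rfl⟩ := ih z.length (by simp <;> omega) z (h1.imp id fun h => ⟨h, hz⟩) rfl
        exact ⟨.e tu t, rfl⟩

/-- Vertices visited, excluding the last one. -/
def vs : List Bool → List ℕ → List (List Bool)
  | _, [] => []
  | x, i :: l => x :: vs (flipAt x i) l

theorem vs_append (x : List Bool) (l m : List ℕ) :
    vs x (l ++ m) = vs x l ++ vs (l.foldl flipAt x) m := by
  induction l generalizing x with
  | nil => rfl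
  | cons i l ih => simp [vs, ih]

theorem range_map_eq (x : List Bool) (l : List ℕ) :
    (List.range (l.length + 1)).map (fun k => (l.take k).foldl flipAt x)
      = vs x l ++ [l.foldl flipAt x] := by
  induction l generalizing x with
  | nil => simp [vs]
  | cons i l ih =>
    rw [List.length_cons, List.range_succ_eq_map, List.map_cons, List.map_map]
    simp only [vs, List.cons_append, List.foldl_cons, ← ih]
    rfl

theorem flipAt_eq (p q : List Bool) (b : Bool) (i : ℕ) (h : i = p.length + 1) :
    flipAt (p ++ b :: q) i = p ++ (!b) :: q := by
  subst h
  simp [flipAt]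

theorem path_aux (s : ℕ → List Bool → List ℕ)
    (hs0 : ∀ a : ℕ, s a [] = [])
    (hsrec : ∀ (a : ℕ) (u' v' : List Bool), isDyck u' → isDyck v' →
      s a ([true] ++ u' ++ [false] ++ v') =
        [a + u'.length + 1, a] ++ s (a + 1) u' ++ [a - 1, a + u'.length + 1] ++
          s (a + u'.length + 2) v') (t : DT) :
    ∀ (p q : List Bool) (a : ℕ), a = p.length + 2 →
      (s a (word t)).foldl flipAt (p ++ false :: (word t ++ q)) = p ++ (word t ++ false :: q) ∧
      vs (p ++ false :: (word t ++ q)) (s a (word t)) ++ [p ++ (word t ++ false :: q)]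
        = (Qs t).map (fun z => p ++ (vstr z ++ q)) := by
  induction t with
  | leaf =>
    intro p q a ha
    simp [word, hs0, vs, Qs, vstr]
  | node u v hu hv =>
    intro p q a ha
    have e0 : word (.node u v) = [true] ++ word u ++ [false] ++ word v := by simp [word]
    have f1 : flipAt (p ++ false :: (word (.node u v) ++ q)) (a + (word u).length + 1)
        = p ++ false :: true :: (word u ++ true :: (word v ++ q)) := by
      have := flipAt_eq (p ++ false :: true :: word u) (word v ++ q) false
        (a + (word u).length + 1) (by simp <;> omega)
      simpa [word] using this
    have f2 : flipAt (p ++ false :: true :: (word u ++ true :: (word v ++ q))) a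
        = (p ++ [false]) ++ false :: (word u ++ true :: (word v ++ q)) := by
      have := flipAt_eq (p ++ [false]) (word u ++ true :: (word v ++ q)) true a (by simp <;> omega)
      simpa using this
    obtain ⟨f3, g3⟩ := hu (p ++ [false]) (true :: (word v ++ q)) (a + 1) (by simp <;> omega)
    have f4 : flipAt ((p ++ [false]) ++ (word u ++ false :: true :: (word v ++ q))) (a - 1)
        = p ++ true :: (word u ++ false :: true :: (word v ++ q)) := by
      have := flipAt_eq p (word u ++ false :: true :: (word v ++ q)) false (a - 1) (by omega)
      simpa using this
    have f5 : flipAt (p ++ true :: (word u ++ false :: true :: (word v ++ q)))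
        (a + (word u).length + 1)
        = (p ++ true :: (word u ++ [false])) ++ false :: (word v ++ q) := by
      have := flipAt_eq (p ++ true :: (word u ++ [false])) (word v ++ q) true
        (a + (word u).length + 1) (by simp <;> omega)
      simpa using this
    obtain ⟨f6, g6⟩ := hv (p ++ true :: (word u ++ [false])) q (a + (word u).length + 2)
      (by simp <;> omega)
    have hs := hsrec a (word u) (word v) (word_dyck u) (word_dyck v)
    rw [← e0] at hs
    rw [hs]
    constructor
    · simp only [List.foldl_append, List.foldl_cons, List.foldl_nil, f1, f2, f3, f4, f5, f6]
      simp [word]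
    · simp only [vs_append, List.foldl_append, List.foldl_cons, List.foldl_nil, f1, f2, f3, f4, f5,
        vs]
      have e1 : p ++ (word (.node u v) ++ false :: q)
        = (p ++ true :: (word u ++ [false])) ++ (word v ++ false :: q) := by simp [word]
      rw [e1, List.append_assoc, g6]
      have e2 : ∀ (A B X : List (List Bool)) (x y : List Bool),
        (A ++ X ++ [x, y]) ++ B = A ++ ((X ++ [x]) ++ (y :: B)) := by intros; simp
      rw [e2, g3]
      simp [Qs, Pfst, vstr, word, Function.comp_def]

theorem path_main (s : ℕ → List Bool → List ℕ) (sig : List Bool → List ℕ)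
    (hs0 : ∀ a : ℕ, s a [] = [])
    (hsrec : ∀ (a : ℕ) (u' v' : List Bool), isDyck u' → isDyck v' →
      s a ([true] ++ u' ++ [false] ++ v') =
        [a + u'.length + 1, a] ++ s (a + 1) u' ++ [a - 1, a + u'.length + 1] ++
          s (a + u'.length + 2) v')
    (hsig : ∀ u v : List Bool, isDyck u → isDyck v →
      sig ([true] ++ u ++ [false] ++ v) = [u.length + 2, 1] ++ s 2 u) (u v : DT) :
    ((List.range ((sig (word (.node u v))).length + 1)).map
        (fun k => ((sig (word (.node u v))).take k).foldl flipAt (word (.node u v)))).map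
          (fun y => false :: y) = (Pfst (Qs u) u v).map vstr := by
  rw [range_map_eq]
  have e0 : word (.node u v) = [true] ++ word u ++ [false] ++ word v := by simp [word]
  have hs := hsig (word u) (word v) (word_dyck u) (word_dyck v)
  rw [← e0] at hs
  rw [hs]
  have f1 : flipAt (word (.node u v)) ((word u).length + 2)
      = true :: (word u ++ true :: word v) := by
    have := flipAt_eq (true :: word u) (word v) false ((word u).length + 2) (by simp)
    simpa [word] using this
  have f2 : flipAt (true :: (word u ++ true :: word v)) 1
      = [] ++ false :: (word u ++ true :: word v) := by
    have := flipAt_eq [] (word u ++ true :: word v) true 1 (by simp)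
    simpa using this
  obtain ⟨f3, g3⟩ := path_aux s hs0 hsrec u [] (true :: word v) 2 (by simp)
  simp only [vs_append, List.foldl_append, List.foldl_cons, List.foldl_nil, f1, f2, f3, vs]
  rw [List.append_assoc, g3]
  simp [Pfst, vstr, Function.comp_def]

/-- The paths `P_σ(x)`, `x ∈ D_n`, are pairwise vertex-disjoint and together visit
every bitstring of length `2n` with weight `n` or `n+1` exactly once.  Here `s a x'`
plays the role of `σ_a(x')` and `sig x` plays the role of `σ(x)`; both are required
to satisfy their defining recursions. -/
theorem stmt_13 (n : ℕ) (hn : 1 ≤ n)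
    (s : ℕ → List Bool → List ℕ) (sig : List Bool → List ℕ)
    (hs0 : ∀ a : ℕ, s a [] = [])
    (hsrec : ∀ (a : ℕ) (u' v' : List Bool), isDyck u' → isDyck v' →
      s a ([true] ++ u' ++ [false] ++ v') =
        [a + u'.length + 1, a] ++ s (a + 1) u' ++ [a - 1, a + u'.length + 1] ++
          s (a + u'.length + 2) v')
    (hsig : ∀ u v : List Bool, isDyck u → isDyck v →
      sig ([true] ++ u ++ [false] ++ v) = [u.length + 2, 1] ++ s 2 u) :
    (∀ x ∈ dyckWords n, ∀ x' ∈ dyckWords n, x ≠ x' →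
      Disjoint (pathVerts (sig x) x) (pathVerts (sig x') x')) ∧
    (∀ x ∈ dyckWords n,
      ((List.range ((sig x).length + 1)).map
        (fun k => ((sig x).take k).foldl flipAt x)).Nodup) ∧
    (⋃ x ∈ dyckWords n, pathVerts (sig x) x) =
      {y : List Bool | y.length = 2 * n ∧ (y.count true = n ∨ y.count true = n + 1)} := by
  have hmem : ∀ (u v : DT) (y : List Bool),
      y ∈ pathVerts (sig (word (.node u v))) (word (.node u v)) ↔
        ∃ z ∈ Pfst (Qs u) u v, vstr z = false :: y := by
    intro u v y
    have h := path_main s sig hs0 hsrec hsig u v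
    rw [← List.mem_map, ← h]
    simp only [pathVerts, Set.mem_setOf_eq, List.mem_map, List.mem_range, List.cons.injEq,
      true_and, exists_eq_right, Nat.lt_succ_iff]
    exact exists_congr fun k => and_congr Iff.rfl eq_comm
  have hnode : ∀ x ∈ dyckWords n, ∃ u v, x = word (.node u v) := by
    rintro x ⟨h1, h2⟩
    obtain ⟨t, rfl⟩ := exists_word x h2
    cases t with
    | leaf => simp [word] at h1; omega
    | node u v => exact ⟨u, v, rfl⟩
  have hsub : ∀ u v z, z ∈ Pfst (Qs u) u v → vtree z = .node u v := by
    intro u v z hz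
    exact vtree_of_mem (by rw [Qs]; exact List.mem_append_left _ hz)
  refine ⟨?_, ?_, ?_⟩
  · intro x hx x' hx' hne
    obtain ⟨u, v, rfl⟩ := hnode x hx
    obtain ⟨u', v', rfl⟩ := hnode x' hx'
    rw [Set.disjoint_left]
    intro y hy hy'
    obtain ⟨z, hz, e⟩ := (hmem _ _ _).1 hy
    obtain ⟨z', hz', e'⟩ := (hmem _ _ _).1 hy'
    have := vstr_inj (e.trans e'.symm)
    subst this
    exact hne (by rw [← hsub _ _ _ hz, ← hsub _ _ _ hz'])
  · intro x hx
    obtain ⟨u, v, rfl⟩ := hnode x hx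
    have h := path_main s sig hs0 hsrec hsig u v
    apply List.Nodup.of_map (fun y => false :: y)
    rw [h]
    exact (Pfst_nodup u v).map (fun _ _ h => vstr_inj h)
  · ext y
    have hcount : y.count true + y.count false = y.length := by
      simp
    have ht := tot_eq_count y
    simp only [Set.mem_iUnion, Set.mem_setOf_eq, exists_prop]
    constructor
    · rintro ⟨x, hx, hy⟩
      obtain ⟨u, v, rfl⟩ := hnode x hx
      obtain ⟨z, hz, e⟩ := (hmem _ _ _).1 hy
      have hl := vstr_length z
      have htz := tot_vstr z
      rw [hsub _ _ _ hz, e, hx.1] at hl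
      rw [e] at htz
      simp [tot] at hl htz
      omega
    · rintro ⟨h1, h2⟩
      have hty : tot (false :: y) = -1 ∨ tot (false :: y) = 1 := by
        simp [tot]
        omega
      obtain ⟨z, hz⟩ := vstr_surj (false :: y) (hty.imp id fun h => ⟨h, by simp⟩)
      have hl := vstr_length z
      rw [hz] at hl
      simp at hl
      refine ⟨word (vtree z), ⟨by omega, word_dyck _⟩, ?_⟩
      cases z with
      | a t =>
        cases t with
        | leaf => simp [vtree, word] at hl; subst hl; simp at h1; omega
        | node u v => exact (hmem u v y).2 ⟨_, by simp [Pfst], hz⟩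
      | b u v => exact (hmem u v y).2 ⟨_, by simp [Pfst], hz⟩
      | c z v => exact (hmem (vtree z) v y).2 ⟨_, by simp [Pfst, mem_Qs], hz⟩
      | d u v => simp [vstr] at hz
      | e u z => simp [vstr] at hz
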